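/- arXiv:2210.02292 — 7 statements merged into one kernel-verified Lean document; each statement's English description precedes it below -/
import Mathlib

section
/- Let t be a non-empty palindrome, let t₁ = link(t) be the longest proper palindromic suffix of t, and let t₂ = link(t₁) be the longest proper palindromic suffix of t₁. If |t₂| ≥ 1, then |t| + |t₂| ≥ 2·|t₁|. -/
noncomputable section
open scoped Classical

namespace DEE

variable {α : Type*}

/-- 1-indexed substring `s[i..j]` (empty if `i > j`). -/
def substr (s : List α) (i j : ℕ) : List α := (s.drop (i - 1)).take (j + 1 - i)

/-- Set of start positions (1-indexed) of occurrences of `t` in `s`. -/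
def occ (s t : List α) : Set ℕ :=
  {i | 1 ≤ i ∧ i + t.length - 1 ≤ s.length ∧ (s.drop (i - 1)).take t.length = t}

/-- `v` is a non-empty palindromic substring of `s`. -/
def IsPalSub (s v : List α) : Prop := v ≠ [] ∧ v.Palindrome ∧ v <:+: s

/-- `prelen s i`: length of the longest palindromic prefix of `s[i..|s|]`. -/
def prelen (s : List α) (i : ℕ) : ℕ :=
  sSup {l | 1 ≤ l ∧ l ≤ s.length + 1 - i ∧ (substr s i (i + l - 1)).Palindrome}

/-- `suflen s i`: length of the longest palindromic suffix of `s[1..i]`. -/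
def suflen (s : List α) (i : ℕ) : ℕ :=
  sSup {l | 1 ≤ l ∧ l ≤ i ∧ (substr s (i + 1 - l) i).Palindrome}

/-- longest palindromic prefix of `s[i..|s|]`. -/
def prepal (s : List α) (i : ℕ) : List α := substr s i (i + prelen s i - 1)

/-- longest palindromic suffix of `s[1..i]`. -/
def sufpal (s : List α) (i : ℕ) : List α := substr s (i + 1 - suflen s i) i

/-- The occurrence `s[i..j]` is a surface in `s`. -/
def Surface (s : List α) (i j : ℕ) : Prop :=
  1 ≤ i ∧ i ≤ j ∧ j ≤ s.length ∧ (substr s i j).Palindrome ∧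
    (∀ l, 1 ≤ l → l < i → ¬ (substr s l j).Palindrome) ∧
    (∀ r, j < r → r ≤ s.length → ¬ (substr s i r).Palindrome)

/-- length of the longest proper palindromic suffix of `t`. -/
def linklen (t : List α) : ℕ :=
  sSup {l | l < t.length ∧ (t.drop (t.length - l)).Palindrome}

/-- the longest proper palindromic suffix of `t` (possibly `[]`). -/
def link (t : List α) : List α := t.drop (t.length - linklen t)

/-- `overline-occ`: shifted occurrences `{i + |t| - |link t| : i ∈ occ s t}`. -/
def obar (s t : List α) : Set ℕ := (fun i => i + t.length - (link t).length) '' occ s t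

/-- Eq.(★): the family `S` of reduced occurrence sets represents `occ` for `s`. -/
def SatStar (s : List α) (S : List α → Set ℕ) : Prop :=
  ∀ v, IsPalSub s v →
    occ s v = S v ∪ ⋃ u ∈ {u : List α | IsPalSub s u ∧ link u = v}, (occ s u ∪ obar s u)

/-- number of non-empty palindromic substrings of `s` linking to `v`. -/
def linkcnt (s v : List α) : ℕ := {u | IsPalSub s u ∧ link u = v}.ncard

def precnt (s v : List α) : ℕ := {i | 1 ≤ i ∧ i ≤ s.length ∧ prepal s i = v}.ncard

def sufcnt (s v : List α) : ℕ := {i | 1 ≤ i ∧ i ≤ s.length ∧ sufpal s i = v}.ncard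

def cnt (s v : List α) : ℕ := sufcnt s v

/-- surfaced occurrences of `v` in `s`. -/
def surf (s v : List α) : Set ℕ := {i ∈ occ s v | Surface s i (i + v.length - 1)}

def presurf (s : List α) (i : ℕ) : List α :=
  if Surface s i (i + prelen s i - 1) then prepal s i else []

def sufsurf (s : List α) (i : ℕ) : List α :=
  if Surface s (i + 1 - suflen s i) i then sufpal s i else []

end DEE

namespace DEE

variable {α : Type*}

theorem bddAbove_linklen_set (t : List α) :
    BddAbove {l | l < t.length ∧ (t.drop (t.length - l)).Palindrome} :=
  ⟨t.length, fun _ hl => hl.1.le⟩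

theorem linklen_spec {t : List α} (ht : t ≠ []) :
    linklen t < t.length ∧ (link t).Palindrome :=
  Nat.sSup_mem (s := {l | l < t.length ∧ (t.drop (t.length - l)).Palindrome})
    ⟨0, List.length_pos_of_ne_nil ht, by simpa using List.Palindrome.nil⟩
    (bddAbove_linklen_set t)

theorem le_linklen {t : List α} {l : ℕ} (hl : l < t.length)
    (h : (t.drop (t.length - l)).Palindrome) : l ≤ linklen t :=
  le_csSup (bddAbove_linklen_set t) ⟨hl, h⟩

theorem length_link {t : List α} (ht : t ≠ []) : (link t).length = linklen t := by
  have := (linklen_spec ht).1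
  rw [link, List.length_drop]
  omega

/-- Palindromic suffixes of a palindrome are also prefixes. -/
theorem drop_eq_take_of_palindrome {t : List α} (ht : t.Palindrome) {p : ℕ}
    (h : (t.drop p).Palindrome) : t.drop p = t.take (t.length - p) := by
  rw [← h.reverse_eq, List.reverse_drop, ht.reverse_eq]

/-- If the suffix of a palindrome `t` starting at offset `p` is a palindrome, then so is the
suffix starting at offset `2 * p`. -/
theorem palindrome_drop_drop {t : List α} (ht : t.Palindrome) {p : ℕ}
    (h : (t.drop p).Palindrome) : ((t.drop p).drop p).Palindrome := by
  have e := drop_eq_take_of_palindrome ht h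
  apply List.Palindrome.of_reverse_eq
  rw [List.reverse_drop, h.reverse_eq]
  conv_rhs => rw [e, List.drop_take]
  rw [List.length_drop]

end DEE

/-- For a non-empty palindrome `t` with `t₁ = link t`, `t₂ = link t₁`,
if `|t₂| ≥ 1` then `|t| + |t₂| ≥ 2|t₁|`. -/
theorem length_link_convex {α : Type*} (t : List α) (ht : t ≠ []) (htp : t.Palindrome)
    (h2 : 1 ≤ (DEE.link (DEE.link t)).length) :
    t.length + (DEE.link (DEE.link t)).length ≥ 2 * (DEE.link t).length := by
  have h1 : DEE.link t ≠ [] := by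
    intro h
    rw [h] at h2
    simp [DEE.link] at h2
  have hlt := DEE.linklen_spec ht
  have hlen := DEE.length_link ht
  have hlen' := DEE.length_link h1
  by_contra! hc
  have hle : (DEE.link t).length - (t.length - DEE.linklen t)
      ≤ DEE.linklen (DEE.link t) := by
    apply DEE.le_linklen
    · omega
    · rw [Nat.sub_sub_self (by omega)]
      exact DEE.palindrome_drop_drop htp hlt.2
  omega
end
end

section
/- Let s be a non-empty string and suppose the family S satisfies Eq.(★) for s. Let 1 ≤ i ≤ |s| be such that s[i..|s|] is a palindrome, and let v = s[i..|s|]. Then v occurs exactly once in s (i.e., |occ(s,v)| = 1) if and only if linkcnt(s,v) = 0 and |S(v)| = 1. -/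
noncomputable section
open scoped Classical

namespace DEE

theorem linklen_lt {α : Type*} {t : List α} (ht : t ≠ []) : linklen t < t.length := by
  have hne : {l | l < t.length ∧ (t.drop (t.length - l)).Palindrome}.Nonempty :=
    ⟨0, List.length_pos_iff.2 ht, by simpa using List.Palindrome.nil⟩
  exact (Nat.sSup_mem hne ⟨t.length, fun l hl => hl.1.le⟩).1

theorem length_link_lt {α : Type*} {t : List α} (ht : t ≠ []) :
    (link t).length < t.length := by
  have := linklen_lt ht
  simp only [link, List.length_drop]
  omega

theorem occ_nonempty {α : Type*} {s t : List α} (h : t <:+: s) : (occ s t).Nonempty := by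
  obtain ⟨a, b, rfl⟩ := h
  refine ⟨a.length + 1, by omega, ?_, ?_⟩
  · simp only [List.length_append]
    omega
  · simp

theorem finite_setOf_isPalSub_link {α : Type*} (s v : List α) :
    {u | IsPalSub s u ∧ link u = v}.Finite := by
  refine (List.finite_toSet s.sublists).subset fun u hu => ?_
  exact List.mem_sublists.2 hu.1.2.2.sublist

theorem linkcnt_eq_zero_iff {α : Type*} {s v : List α} :
    linkcnt s v = 0 ↔ {u | IsPalSub s u ∧ link u = v} = ∅ :=
  Set.ncard_eq_zero (finite_setOf_isPalSub_link s v)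

theorem isPalSub_substr {α : Type*} {s : List α} {i : ℕ} (h1 : 1 ≤ i) (h2 : i ≤ s.length)
    (hpal : (substr s i s.length).Palindrome) : IsPalSub s (substr s i s.length) := by
  refine ⟨List.ne_nil_of_length_pos ?_, hpal, ?_⟩
  · simp only [substr, List.length_take, List.length_drop]
    omega
  · exact (List.take_prefix _ _).isInfix.trans (List.drop_suffix _ _).isInfix

/-- A palindrome that occurs only once is not linked to by any palindromic substring. -/
theorem SatStar.linkcnt_eq_zero {α : Type*} {s v : List α} {S : List α → Set ℕ}
    (hS : SatStar s S) (hv : IsPalSub s v) (h : (occ s v).ncard = 1) : linkcnt s v = 0 := by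
  rw [linkcnt_eq_zero_iff, Set.eq_empty_iff_forall_notMem]
  intro u hu
  have hsub : occ s u ∪ obar s u ⊆ occ s v := by
    rw [hS v hv]
    exact Set.subset_union_of_subset_right
      (Set.subset_biUnion_of_mem (u := fun u => occ s u ∪ obar s u) hu) _
  obtain ⟨j, hj⟩ := occ_nonempty hu.1.2.2
  obtain ⟨a, ha⟩ := Set.ncard_eq_one.1 h
  rw [ha] at hsub
  have hj₁ : j = a := hsub (Or.inl hj)
  have hj₂ : j + u.length - (link u).length = a := hsub (Or.inr ⟨j, hj, rfl⟩)
  have := length_link_lt hu.1.1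
  omega

theorem SatStar.occ_eq {α : Type*} {s v : List α} {S : List α → Set ℕ}
    (hS : SatStar s S) (hv : IsPalSub s v) (h : linkcnt s v = 0) : occ s v = S v := by
  rw [hS v hv, linkcnt_eq_zero_iff.1 h]
  simp

end DEE

/-- If `S` satisfies Eq.(★) for a non-empty string `s` and `s[i..|s|]`
is a palindrome `v`, then `v` occurs exactly once in `s` iff `linkcnt(s,v) = 0` and
`|S(v)| = 1`. -/
theorem unique_by_reduced_set {α : Type*} (s : List α) (hs : s ≠ [])
    (S : List α → Set ℕ) (hS : DEE.SatStar s S)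
    (i : ℕ) (h1 : 1 ≤ i) (h2 : i ≤ s.length)
    (hpal : (DEE.substr s i s.length).Palindrome) :
    (DEE.occ s (DEE.substr s i s.length)).ncard = 1 ↔
      DEE.linkcnt s (DEE.substr s i s.length) = 0 ∧
        (S (DEE.substr s i s.length)).ncard = 1 := by
  have hv := DEE.isPalSub_substr h1 h2 hpal
  constructor
  · intro h
    have h0 := hS.linkcnt_eq_zero hv h
    exact ⟨h0, hS.occ_eq hv h0 ▸ h⟩
  · rintro ⟨h0, h⟩
    rwa [hS.occ_eq hv h0]
end
end

section
/- Let s be a string and c a character, and suppose the family S(s,·) satisfies Eq.(★) for s. Let v' = prepal(cs,1), the longest palindromic prefix of cs. Define, for each non-empty palindromic substring v of cs: S(cs,v) = ({x+1 : x ∈ S(s,v)}) ∪ {1} if v = v', and S(cs,v) = {x+1 : x ∈ S(s,v)} otherwise, where S(s,v) = ∅ if v is not a substring of s. Then the family S(cs,·) satisfies Eq.(★) for cs. -/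
noncomputable section
open scoped Classical

namespace DEE

theorem succ_mem_occ {α : Type*} {s t : List α} (ht : t ≠ []) (j : ℕ) :
    j + 1 ∈ occ s t ↔ t <+: s.drop j := by
  have hpos := List.length_pos_of_ne_nil ht
  simp only [occ, Set.mem_ofPred_eq, Nat.add_sub_cancel]
  constructor
  · rintro ⟨-, -, h⟩
    exact List.prefix_iff_eq_take.2 h.symm
  · intro h
    have hl := h.length_le
    rw [List.length_drop] at hl
    exact ⟨by omega, by omega, (List.prefix_iff_eq_take.1 h).symm⟩

theorem exists_eq_succ_of_mem_occ {α : Type*} {s t : List α} {i : ℕ} (h : i ∈ occ s t) :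
    ∃ j, i = j + 1 :=
  Nat.exists_eq_add_of_le' h.1

theorem succ_mem_occ_cons {α : Type*} {s t : List α} (ht : t ≠ []) (c : α) {i : ℕ}
    (hi : i ∈ occ s t) : i + 1 ∈ occ (c :: s) t := by
  obtain ⟨j, rfl⟩ := exists_eq_succ_of_mem_occ hi
  rw [succ_mem_occ ht] at hi ⊢
  simpa using hi

theorem one_mem_occ {α : Type*} {s t : List α} (ht : t ≠ []) : 1 ∈ occ s t ↔ t <+: s := by
  simpa using succ_mem_occ (s := s) ht 0

theorem isInfix_of_mem_occ {α : Type*} {s t : List α} (ht : t ≠ []) {i : ℕ}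
    (hi : i ∈ occ s t) : t <:+: s := by
  obtain ⟨j, rfl⟩ := exists_eq_succ_of_mem_occ hi
  exact ((succ_mem_occ ht j).1 hi).isInfix.trans (List.drop_suffix j s).isInfix

theorem occ_subset_occ_of_prefix {α : Type*} {s t v : List α} (hv : v ≠ []) (h : v <+: t) :
    occ s t ⊆ occ s v := by
  intro i hi
  have ht : t ≠ [] := by
    rintro rfl
    exact hv (List.prefix_nil.1 h)
  obtain ⟨j, rfl⟩ := exists_eq_succ_of_mem_occ hi
  rw [succ_mem_occ ht] at hi
  exact (succ_mem_occ hv j).2 (h.trans hi)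

theorem linklen_mem {α : Type*} {t : List α} (ht : t ≠ []) :
    linklen t < t.length ∧ (t.drop (t.length - linklen t)).Palindrome := by
  refine Nat.sSup_mem (s := {l | l < t.length ∧ (t.drop (t.length - l)).Palindrome})
    ⟨0, List.length_pos_of_ne_nil ht, ?_⟩ ⟨t.length, fun l hl => hl.1.le⟩
  simpa using List.Palindrome.nil

theorem link_suffix {α : Type*} (t : List α) : link t <:+ t := List.drop_suffix _ _

theorem isPrefix_iff_isSuffix {α : Type*} {t v : List α} (ht : t.Palindrome)
    (hv : v.Palindrome) : v <+: t ↔ v <:+ t := by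
  rw [← List.reverse_prefix, ht.reverse_eq, hv.reverse_eq]

theorem link_palindrome {α : Type*} {t : List α} (ht : t ≠ []) : (link t).Palindrome :=
  (linklen_mem ht).2

theorem link_prefix {α : Type*} {t : List α} (ht : t ≠ []) (hp : t.Palindrome) :
    link t <+: t :=
  (isPrefix_iff_isSuffix hp (link_palindrome ht)).2 (link_suffix t)

theorem length_le_length_link {α : Type*} {t v : List α} (hv : v.Palindrome) (h : v <:+ t)
    (hlt : v.length < t.length) : v.length ≤ (link t).length := by
  have hle : v.length ≤ linklen t :=
    le_csSup (s := {l | l < t.length ∧ (t.drop (t.length - l)).Palindrome})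
      ⟨t.length, fun l hl => hl.1.le⟩ ⟨hlt, by rwa [← List.suffix_iff_eq_drop.1 h]⟩
  have := (linklen_mem (List.ne_nil_of_length_pos (by omega : 0 < t.length))).1
  rw [link, List.length_drop]
  omega

theorem obar_subset_occ_link {α : Type*} (s : List α) {t : List α} (hl : link t ≠ []) :
    obar s t ⊆ occ s (link t) := by
  rintro _ ⟨i, hi, rfl⟩
  have ht : t ≠ [] := fun h => hl (by simp [link, h])
  have hlt := length_link_lt ht
  obtain ⟨j, rfl⟩ := exists_eq_succ_of_mem_occ hi
  rw [succ_mem_occ ht] at hi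
  have he : j + 1 + t.length - (link t).length = (j + (t.length - (link t).length)) + 1 := by
    omega
  simp only [he]
  rw [succ_mem_occ hl, ← List.drop_drop]
  have hd := hi.drop (t.length - (link t).length)
  rwa [← List.suffix_iff_eq_drop.1 (link_suffix t)] at hd

theorem succ_mem_obar_cons {α : Type*} {s t : List α} (ht : t ≠ []) (c : α) {i : ℕ}
    (hi : i ∈ obar s t) : i + 1 ∈ obar (c :: s) t := by
  obtain ⟨j, hj, rfl⟩ := hi
  have := length_link_lt ht
  exact ⟨j + 1, succ_mem_occ_cons ht c hj, by simp only; omega⟩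

theorem IsPalSub.cons {α : Type*} {s t : List α} (h : IsPalSub s t) (c : α) :
    IsPalSub (c :: s) t :=
  ⟨h.1, h.2.1, h.2.2.trans (List.suffix_cons c s).isInfix⟩

theorem prepal_one_eq_take {α : Type*} (s : List α) : prepal s 1 = s.take (prelen s 1) := by
  simp [prepal, substr]

theorem prepal_one_prefix {α : Type*} (s : List α) : prepal s 1 <+: s := by
  rw [prepal_one_eq_take]
  exact List.take_prefix _ _

theorem length_le_length_prepal_one {α : Type*} {s v : List α} (hv : v.Palindrome)
    (hne : v ≠ []) (h : v <+: s) :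
    v.length ≤ (prepal s 1).length ∧ (prepal s 1).Palindrome := by
  let A := {l | 1 ≤ l ∧ l ≤ s.length + 1 - 1 ∧ (substr s 1 (1 + l - 1)).Palindrome}
  have hb : BddAbove A := ⟨s.length + 1 - 1, fun l hl => hl.2.1⟩
  have hmem : v.length ∈ A := by
    refine ⟨List.length_pos_of_ne_nil hne, by simpa using h.length_le, ?_⟩
    simpa [substr, ← List.prefix_iff_eq_take.1 h] using hv
  have hle : v.length ≤ prelen s 1 := le_csSup hb hmem
  have hspec : prelen s 1 ∈ A := Nat.sSup_mem ⟨_, hmem⟩ hb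
  refine ⟨?_, hspec.2.2⟩
  rw [prepal_one_eq_take, List.length_take]
  exact le_min hle h.length_le

theorem exists_prefix_link_eq {α : Type*} {s v w : List α} (hv : v.Palindrome) (hvs : v <+: s)
    (hw : w.Palindrome) (hws : w <+: s) (hlt : v.length < w.length) :
    ∃ u, u ≠ [] ∧ u.Palindrome ∧ u <+: s ∧ link u = v := by
  let P := fun n => ∃ u : List α, u.Palindrome ∧ u <+: s ∧ v.length < u.length ∧ u.length = n
  have hex : ∃ n, P n := ⟨_, w, hw, hws, hlt, rfl⟩
  obtain ⟨u, hu, hus, hvu, hun⟩ := Nat.find_spec hex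
  have hne : u ≠ [] := List.ne_nil_of_length_pos (by omega)
  have hlink := (link_prefix hne hu).trans hus
  have hle : v.length ≤ (link u).length :=
    length_le_length_link hv
      ((isPrefix_iff_isSuffix hu hv).1 (List.prefix_of_prefix_length_le hvs hus hvu.le)) hvu
  have hge : (link u).length ≤ v.length := by
    by_contra! hgt
    have hmin := Nat.find_min' hex ⟨link u, link_palindrome hne, hlink, hgt, rfl⟩
    have := length_link_lt hne
    omega
  exact ⟨u, hne, hu, hus,
    ((List.prefix_of_prefix_length_le hvs hlink hle).eq_of_length (by omega)).symm⟩

end DEE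

/-- (`push_front` correctness.) If `S` satisfies Eq.(★) for `s` (and
`S(v) = ∅` for `v` not a palindromic substring of `s`), then the family obtained by
shifting all positions right by one and adding position `1` to `S(v')`, where `v'` is the
longest palindromic prefix of `cs`, satisfies Eq.(★) for `cs`. -/
theorem push_front_occurrence_recording {α : Type*} (s : List α) (c : α)
    (S : List α → Set ℕ) (hS : DEE.SatStar s S)
    (hS0 : ∀ v, ¬ DEE.IsPalSub s v → S v = ∅) :
    DEE.SatStar (c :: s)
      (fun v =>
        if v = DEE.prepal (c :: s) 1 then ((· + 1) '' S v) ∪ {1}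
        else (· + 1) '' S v) := by
  rintro v ⟨hne, hpal, -⟩
  ext x
  simp only [Set.mem_union, Set.mem_iUnion, Set.mem_ofPred_eq, exists_prop]
  constructor
  · intro hx
    obtain ⟨j, rfl⟩ := DEE.exists_eq_succ_of_mem_occ hx
    rcases j with _ | k
    · have hpre := (DEE.one_mem_occ hne).1 hx
      by_cases hv : v = DEE.prepal (c :: s) 1
      · left
        rw [if_pos hv]
        exact Or.inr rfl
      · obtain ⟨hle, hpp⟩ := DEE.length_le_length_prepal_one hpal hne hpre
        have hpp_pre := DEE.prepal_one_prefix (c :: s)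
        have hlt : v.length < (DEE.prepal (c :: s) 1).length :=
          lt_of_le_of_ne hle fun h =>
            hv ((List.prefix_of_prefix_length_le hpre hpp_pre hle).eq_of_length h)
        obtain ⟨u, hu, hup, hus, hl⟩ := DEE.exists_prefix_link_eq hpal hpre hpp hpp_pre hlt
        exact Or.inr ⟨u, ⟨⟨hu, hup, hus.isInfix⟩, hl⟩, Or.inl ((DEE.one_mem_occ hu).2 hus)⟩
    · have hk : k + 1 ∈ DEE.occ s v := by
        rw [DEE.succ_mem_occ hne] at hx ⊢
        simpa using hx
      have hstar := hS v ⟨hne, hpal, DEE.isInfix_of_mem_occ hne hk⟩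
      rw [hstar] at hk
      simp only [Set.mem_union, Set.mem_iUnion, Set.mem_ofPred_eq, exists_prop] at hk
      rcases hk with hk | ⟨u, ⟨hu, hl⟩, hk⟩
      · left
        split_ifs
        · exact Or.inl ⟨_, hk, rfl⟩
        · exact ⟨_, hk, rfl⟩
      · exact Or.inr ⟨u, ⟨hu.cons c, hl⟩,
          hk.imp (DEE.succ_mem_occ_cons hu.1 c) (DEE.succ_mem_obar_cons hu.1 c)⟩
  · have hshift : ∀ y ∈ (· + 1) '' S v, y ∈ DEE.occ (c :: s) v := by
      rintro _ ⟨y, hy, rfl⟩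
      have hv : DEE.IsPalSub s v := by
        by_contra h
        simp [hS0 v h] at hy
      refine DEE.succ_mem_occ_cons hne c ?_
      rw [hS v hv]
      exact Or.inl hy
    rintro (hx | ⟨u, ⟨hu, rfl⟩, hx | hx⟩)
    · split_ifs at hx with hv
      · rcases hx with hx | rfl
        · exact hshift x hx
        · exact (DEE.one_mem_occ hne).2 (hv ▸ DEE.prepal_one_prefix (c :: s))
      · exact hshift x hx
    · exact DEE.occ_subset_occ_of_prefix hne (DEE.link_prefix hu.1 hu.2.1) hx
    · exact DEE.obar_subset_occ_link _ hne hx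
end
end

section
/- Let s be a string and let v be a non-empty palindromic substring of s. Then precnt(s,v) = sufcnt(s,v); that is, the number of positions 1 ≤ i ≤ |s| such that the longest palindromic prefix of s[i..|s|] equals v is the same as the number of positions 1 ≤ i ≤ |s| such that the longest palindromic suffix of s[1..i] equals v. -/
noncomputable section
open scoped Classical

namespace DEE

variable {α : Type*}

/-- The factor of `s` of length `l` that starts after the first `i` letters. -/
def factor (s : List α) (i l : ℕ) : List α := (s.drop i).take l

/-- The factor of `s` at offset `i` of length `l` fits into `s` and is a palindrome. -/
def PalAt (s : List α) (i l : ℕ) : Prop := i + l ≤ s.length ∧ (factor s i l).Palindrome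

/-- `v` occurs in `s` at offset `i`. -/
def OccAt (s v : List α) (i : ℕ) : Prop :=
  i + v.length ≤ s.length ∧ factor s i v.length = v

lemma length_factor {s : List α} {i l : ℕ} (h : i + l ≤ s.length) :
    (factor s i l).length = l := by
  simp only [factor, List.length_take, List.length_drop]
  omega

/-- Suffixes of a palindromic factor are the reversed prefixes of the same length. -/
lemma PalAt.factor_suffix {s : List α} {i l m : ℕ} (h : PalAt s i l) (hm : m ≤ l) :
    factor s (i + l - m) m = (factor s i m).reverse := by
  have h1 : factor s i m = (factor s i l).take m := by
    simp [factor, List.take_take, hm]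
  have h2 : factor s (i + l - m) m = (factor s i l).drop (l - m) := by
    simp only [factor, List.drop_take, List.drop_drop]
    congr 2 <;> omega
  rw [h1, h2, List.reverse_take, h.2.reverse_eq, length_factor h.1]

lemma palindrome_reverse_iff {t : List α} : t.reverse.Palindrome ↔ t.Palindrome := by
  rw [List.Palindrome.iff_reverse_eq, List.Palindrome.iff_reverse_eq, List.reverse_reverse, eq_comm]

lemma PalAt.suffix_iff {s : List α} {i l m : ℕ} (h : PalAt s i l) (hm : m ≤ l) :
    PalAt s (i + l - m) m ↔ PalAt s i m := by
  have := h.1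
  unfold PalAt
  rw [h.factor_suffix hm, palindrome_reverse_iff]
  exact and_congr_left fun _ => by omega

lemma PalAt.occAt_suffix_iff {s v : List α} {i l : ℕ} (h : PalAt s i l) (hv : v.Palindrome)
    (hm : v.length ≤ l) : OccAt s v (i + l - v.length) ↔ OccAt s v i := by
  have := h.1
  unfold OccAt
  rw [h.factor_suffix hm, List.reverse_eq_iff, hv.reverse_eq]
  exact and_congr_left fun _ => by omega

/-- Palindromic factors whose longest proper palindromic prefix (equivalently, suffix) is `v`. -/
def linked (s v : List α) : Set (ℕ × ℕ) :=
  {p | v.length < p.2 ∧ PalAt s p.1 p.2 ∧ OccAt s v p.1 ∧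
    ∀ m, v.length < m → m < p.2 → ¬ PalAt s p.1 m}

/-- Occurrences of `v` that extend to the right to a longer palindrome. -/
def rightExt (s v : List α) : Set ℕ :=
  {i | OccAt s v i ∧ ∃ l, v.length < l ∧ PalAt s i l}

/-- Occurrences of `v` that extend to the left to a longer palindrome. -/
def leftExt (s v : List α) : Set ℕ :=
  {i | OccAt s v i ∧ ∃ l, v.length < l ∧ l ≤ i + v.length ∧ PalAt s (i + v.length - l) l}

lemma ncard_linked_eq_rightExt (s v : List α) : (linked s v).ncard = (rightExt s v).ncard := by
  refine Set.ncard_congr (fun p _ => p.1) ?_ ?_ ?_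
  · rintro ⟨i, l⟩ ⟨h1, h2, h3, -⟩
    exact ⟨h3, l, h1, h2⟩
  · rintro ⟨i, l⟩ ⟨i', l'⟩ ⟨h1, h2, -, h4⟩ ⟨h1', h2', -, h4'⟩ (rfl : i = i')
    rcases lt_trichotomy l l' with h | h | h
    · exact absurd h2 (h4' l h1 h)
    · rw [h]
    · exact absurd h2' (h4 l' h1' h)
  · rintro i ⟨ho, hl⟩
    refine ⟨(i, Nat.find hl), ⟨(Nat.find_spec hl).1, (Nat.find_spec hl).2, ho, ?_⟩, rfl⟩
    exact fun m hm hlt hp => Nat.find_min hl hlt ⟨hm, hp⟩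

lemma ncard_linked_eq_leftExt (s v : List α) (hv : v.Palindrome) :
    (linked s v).ncard = (leftExt s v).ncard := by
  refine Set.ncard_congr (fun p _ => p.1 + p.2 - v.length) ?_ ?_ ?_
  · rintro ⟨i, l⟩ ⟨h1, h2, h3, -⟩
    dsimp only at h1 h2 h3 ⊢
    refine ⟨(h2.occAt_suffix_iff hv h1.le).2 h3, l, h1, by omega, ?_⟩
    rwa [show i + l - v.length + v.length - l = i by omega]
  · rintro ⟨i, l⟩ ⟨i', l'⟩ ⟨h1, h2, -, h4⟩ ⟨h1', h2', -, h4'⟩ h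
    dsimp only at h1 h2 h4 h1' h2' h4' h
    have he : i + l = i' + l' := by omega
    rcases lt_trichotomy l l' with h | h | h
    · refine absurd ((h2'.suffix_iff h.le).1 ?_) (h4' l h1 h)
      rwa [show i' + l' - l = i by omega]
    · rw [h, show i = i' by omega]
    · refine absurd ((h2.suffix_iff h.le).1 ?_) (h4 l' h1' h)
      rwa [show i + l - l' = i' by omega]
  · rintro j ⟨ho, hl⟩
    obtain ⟨h1, h2, h3⟩ := Nat.find_spec hl
    have hmin := fun m => @Nat.find_min _ _ hl m
    generalize Nat.find hl = l at h1 h2 h3 hmin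
    have hj : j + v.length - l + l - v.length = j := by omega
    refine ⟨(j + v.length - l, l), ⟨h1, h3, ?_, ?_⟩, hj⟩
    · rw [← h3.occAt_suffix_iff hv h1.le, hj]
      exact ho
    · intro m hm hlt hp
      refine hmin m hlt ⟨hm, by omega, ?_⟩
      have := (h3.suffix_iff (m := m) (le_of_lt hlt)).2 hp
      rwa [show j + v.length - l + l - m = j + v.length - m by omega] at this

lemma palindrome_factor_one (s : List α) (i : ℕ) : (factor s i 1).Palindrome := by
  rw [List.Palindrome.iff_reverse_eq, factor]
  cases s.drop i <;> simp

lemma isGreatest_prelen {s : List α} {i : ℕ} (hi : i < s.length) :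
    IsGreatest {l | 1 ≤ l ∧ PalAt s i l} (prelen s (i + 1)) := by
  have he : {l | 1 ≤ l ∧ l ≤ s.length + 1 - (i + 1) ∧
      (substr s (i + 1) (i + 1 + l - 1)).Palindrome} = {l | 1 ≤ l ∧ PalAt s i l} := by
    ext l
    simp only [Set.mem_ofPred_eq, substr, PalAt, factor]
    rw [show i + 1 - 1 = i by omega, show i + 1 + l - 1 + 1 - (i + 1) = l by omega]
    exact and_congr_right fun _ => and_congr_left fun _ => by omega
  have hb : BddAbove {l | 1 ≤ l ∧ PalAt s i l} :=
    ⟨s.length, fun l hl => by have := hl.2.1; omega⟩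
  rw [prelen, he]
  exact ⟨Nat.sSup_mem ⟨1, le_rfl, by omega, palindrome_factor_one s i⟩ hb, fun l hl => le_csSup hb hl⟩

lemma isGreatest_suflen {s : List α} {j : ℕ} (h1 : 1 ≤ j) (hj : j ≤ s.length) :
    IsGreatest {l | 1 ≤ l ∧ l ≤ j ∧ PalAt s (j - l) l} (suflen s j) := by
  have he : {l | 1 ≤ l ∧ l ≤ j ∧ (substr s (j + 1 - l) j).Palindrome} =
      {l | 1 ≤ l ∧ l ≤ j ∧ PalAt s (j - l) l} := by
    ext l
    refine and_congr_right fun _ => and_congr_right fun hl => ?_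
    simp only [substr, PalAt, factor]
    rw [show j + 1 - l - 1 = j - l by omega, show j + 1 - (j + 1 - l) = l by omega]
    exact ⟨fun h => ⟨by omega, h⟩, fun h => h.2⟩
  have hb : BddAbove {l | 1 ≤ l ∧ l ≤ j ∧ PalAt s (j - l) l} := ⟨j, fun l hl => hl.2.1⟩
  rw [suflen, he]
  exact ⟨Nat.sSup_mem ⟨1, le_rfl, h1, by omega, palindrome_factor_one s _⟩ hb,
    fun l hl => le_csSup hb hl⟩

lemma OccAt.palAt {s v : List α} {i : ℕ} (h : OccAt s v i) (hv : v.Palindrome) :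
    PalAt s i v.length := ⟨h.1, by rwa [h.2]⟩

lemma prepal_eq_iff {s v : List α} (hne : v ≠ []) (hv : v.Palindrome) {i : ℕ}
    (hi : i < s.length) : prepal s (i + 1) = v ↔ OccAt s v i ∧ i ∉ rightExt s v := by
  have hpos := List.length_pos_iff.2 hne
  obtain ⟨⟨h1, h2⟩, h3⟩ := isGreatest_prelen hi
  have he : prepal s (i + 1) = factor s i (prelen s (i + 1)) := by
    simp only [prepal, substr, factor]
    congr 1
    omega
  rw [he]
  constructor
  · intro h
    have hl : prelen s (i + 1) = v.length := by rw [← h, length_factor h2.1]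
    rw [hl] at h h2 h3
    exact ⟨⟨h2.1, h⟩, fun ⟨_, l, hl, hp⟩ => absurd (h3 ⟨by omega, hp⟩) (by omega)⟩
  · rintro ⟨ho, hn⟩
    have hle : v.length ≤ prelen s (i + 1) := h3 ⟨hpos, ho.palAt hv⟩
    have : ¬ v.length < prelen s (i + 1) := fun hlt => hn ⟨ho, _, hlt, h2⟩
    rw [show prelen s (i + 1) = v.length by omega]
    exact ho.2

lemma sufpal_eq_iff {s v : List α} (hne : v ≠ []) (hv : v.Palindrome) {j : ℕ}
    (h1j : 1 ≤ j) (hj : j ≤ s.length) :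
    sufpal s j = v ↔ v.length ≤ j ∧ OccAt s v (j - v.length) ∧ j - v.length ∉ leftExt s v := by
  have hpos := List.length_pos_iff.2 hne
  obtain ⟨⟨h1, h2, h2'⟩, h3⟩ := isGreatest_suflen h1j hj
  have he : sufpal s j = factor s (j - suflen s j) (suflen s j) := by
    simp only [sufpal, substr, factor]
    congr 2 <;> omega
  rw [he]
  constructor
  · intro h
    have hl : suflen s j = v.length := by
      have := length_factor h2'.1
      rwa [h, eq_comm] at this
    rw [hl] at h h2 h2' h3
    refine ⟨h2, ⟨h2'.1, h⟩, fun ⟨_, l, hl, hlj, hp⟩ => ?_⟩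
    rw [show j - v.length + v.length = j by omega] at hlj hp
    exact absurd (h3 ⟨by omega, hlj, hp⟩) (by omega)
  · rintro ⟨hvj, ho, hn⟩
    have hle : v.length ≤ suflen s j := h3 ⟨hpos, hvj, ho.palAt hv⟩
    have : ¬ v.length < suflen s j := fun hlt => hn ⟨ho, _, hlt, by omega, by
      rwa [show j - v.length + v.length = j by omega]⟩
    rw [show suflen s j = v.length by omega]
    exact ho.2

lemma precnt_eq_ncard_diff {s v : List α} (hne : v ≠ []) (hv : v.Palindrome) :
    precnt s v = ({i | OccAt s v i} \ rightExt s v).ncard := by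
  have hpos := List.length_pos_iff.2 hne
  refine (Set.ncard_congr (fun i _ => i + 1) ?_ (fun a b _ _ h => by omega) ?_).symm
  · intro i hi
    have : i < s.length := by have := hi.1.1; omega
    exact ⟨by omega, this, (prepal_eq_iff hne hv this).2 hi⟩
  · rintro i ⟨h1, h2, h3⟩
    obtain ⟨k, rfl⟩ : ∃ k, i = k + 1 := ⟨i - 1, by omega⟩
    exact ⟨k, (prepal_eq_iff hne hv h2).1 h3, rfl⟩

lemma sufcnt_eq_ncard_diff {s v : List α} (hne : v ≠ []) (hv : v.Palindrome) :
    sufcnt s v = ({i | OccAt s v i} \ leftExt s v).ncard := by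
  have hpos := List.length_pos_iff.2 hne
  refine (Set.ncard_congr (fun i _ => i + v.length) ?_ (fun a b _ _ h => by omega) ?_).symm
  · intro i hi
    have hle := hi.1.1
    refine ⟨by omega, hle, (sufpal_eq_iff hne hv (by omega) hle).2 ⟨by omega, ?_⟩⟩
    rwa [Nat.add_sub_cancel]
  · rintro j ⟨h1, h2, h3⟩
    obtain ⟨h4, h5⟩ := (sufpal_eq_iff hne hv h1 h2).1 h3
    exact ⟨j - v.length, h5, by omega⟩

end DEE

/-- For every non-empty palindromic substring `v` of `s`,
`precnt(s,v) = sufcnt(s,v)`. -/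
theorem precnt_eq_sufcnt {α : Type*} (s v : List α) (hv : DEE.IsPalSub s v) :
    DEE.precnt s v = DEE.sufcnt s v := by
  obtain ⟨hne, hpal, -⟩ := hv
  have hfin : {i | DEE.OccAt s v i}.Finite :=
    (Set.finite_Iic s.length).subset fun i hi => by have := hi.1; simp only [Set.mem_Iic]; omega
  have hr : DEE.rightExt s v ⊆ {i | DEE.OccAt s v i} := fun _ h => h.1
  have hl : DEE.leftExt s v ⊆ {i | DEE.OccAt s v i} := fun _ h => h.1
  rw [DEE.precnt_eq_ncard_diff hne hpal, DEE.sufcnt_eq_ncard_diff hne hpal,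
    Set.ncard_sdiff hr (hfin.subset hr), Set.ncard_sdiff hl (hfin.subset hl),
    ← DEE.ncard_linked_eq_rightExt, DEE.ncard_linked_eq_leftExt s v hpal]
end
end

section
/- Let s be a string and let v be a non-empty palindromic substring of s. Then the number of occurrences of v in s satisfies |occ(s,v)| = Σ_u cnt(s,u), where the sum ranges over all non-empty palindromic substrings u of s such that v is a (not necessarily proper) palindromic suffix of u. -/
noncomputable section
open scoped Classical

namespace DEE

variable {α : Type*}

theorem substr_eq_drop_take (s : List α) {l e : ℕ} (hl : l ≤ e) :
    substr s (e + 1 - l) e = (s.take e).drop (e - l) := by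
  rw [substr, List.drop_take]
  congr 1
  · omega
  · congr 1
    omega

/-- A palindromic suffix `t` of `s[1..e]` is at most as long as the longest one. -/
theorem length_le_suflen (s : List α) {t : List α} {e : ℕ} (he : e ≤ s.length) (ht : t ≠ [])
    (hp : t.Palindrome) (hs : t <:+ s.take e) : t.length ≤ suflen s e := by
  have hle := hs.length_le
  rw [List.length_take, min_eq_left he] at hle
  refine le_csSup ⟨e, fun l hl => hl.2.1⟩ ⟨List.length_pos_iff.2 ht, hle, ?_⟩
  rw [substr_eq_drop_take s hle]
  have h := List.suffix_iff_eq_drop.1 hs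
  rw [List.length_take, min_eq_left he] at h
  rwa [← h]

theorem suflen_mem (s : List α) {e : ℕ} (h1 : 1 ≤ e) (he : e ≤ s.length) :
    suflen s e ∈ {l | 1 ≤ l ∧ l ≤ e ∧ (substr s (e + 1 - l) e).Palindrome} := by
  refine Nat.sSup_mem ⟨1, le_rfl, h1, ?_⟩ ⟨e, fun l hl => hl.2.1⟩
  have hlen : ((s.take e).drop (e - 1)).length = 1 := by
    rw [List.length_drop, List.length_take]
    omega
  rw [substr_eq_drop_take s h1]
  obtain ⟨a, ha⟩ := List.length_eq_one_iff.1 hlen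
  rw [ha]
  exact List.Palindrome.singleton a

theorem sufpal_eq (s : List α) {e : ℕ} (h1 : 1 ≤ e) (he : e ≤ s.length) :
    sufpal s e = (s.take e).drop (e - suflen s e) :=
  substr_eq_drop_take s (suflen_mem s h1 he).2.1

theorem sufpal_suffix_take (s : List α) {e : ℕ} (h1 : 1 ≤ e) (he : e ≤ s.length) :
    sufpal s e <:+ s.take e := by
  rw [sufpal_eq s h1 he]
  exact List.drop_suffix _ _

theorem length_sufpal (s : List α) {e : ℕ} (h1 : 1 ≤ e) (he : e ≤ s.length) :
    (sufpal s e).length = suflen s e := by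
  have h := (suflen_mem s h1 he).2.1
  rw [sufpal_eq s h1 he, List.length_drop, List.length_take]
  omega

theorem isPalSub_sufpal (s : List α) {e : ℕ} (h1 : 1 ≤ e) (he : e ≤ s.length) :
    IsPalSub s (sufpal s e) := by
  have h := suflen_mem s h1 he
  refine ⟨?_, h.2.2, (sufpal_suffix_take s h1 he).isInfix.trans (List.take_prefix e s).isInfix⟩
  rw [← List.length_pos_iff, length_sufpal s h1 he]
  exact h.1

theorem suffix_sufpal_iff (s : List α) {v : List α} {e : ℕ} (h1 : 1 ≤ e) (he : e ≤ s.length)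
    (hv : v ≠ []) (hp : v.Palindrome) : v <:+ sufpal s e ↔ v <:+ s.take e := by
  refine ⟨fun h => h.trans (sufpal_suffix_take s h1 he), fun h => ?_⟩
  refine List.suffix_of_suffix_length_le h (sufpal_suffix_take s h1 he) ?_
  rw [length_sufpal s h1 he]
  exact length_le_suflen s he hv hp h

/-- Occurrences of `v`, indexed by their end positions. -/
theorem image_occ (s : List α) {v : List α} (hv : v ≠ []) :
    (fun i => i + v.length - 1) '' occ s v = {e | 1 ≤ e ∧ e ≤ s.length ∧ v <:+ s.take e} := by
  have hpos := List.length_pos_iff.2 hv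
  ext e
  constructor
  · rintro ⟨i, ⟨h1, h2, h3⟩, rfl⟩
    refine ⟨by dsimp only; omega, h2, ?_⟩
    have h : (s.take (i + v.length - 1)).drop (i - 1) = v := by
      rw [List.drop_take, show i + v.length - 1 - (i - 1) = v.length by omega, h3]
    have hs := List.drop_suffix (i - 1) (s.take (i + v.length - 1))
    rwa [h] at hs
  · rintro ⟨h1, h2, h3⟩
    have hle := h3.length_le
    rw [List.length_take, min_eq_left h2] at hle
    refine ⟨e + 1 - v.length, ⟨by omega, by omega, ?_⟩, by dsimp only; omega⟩
    have h := List.suffix_iff_eq_drop.1 h3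
    rw [List.length_take, min_eq_left h2, List.drop_take] at h
    rw [show e + 1 - v.length - 1 = e - v.length by omega]
    rwa [show e - (e - v.length) = v.length by omega, eq_comm] at h

theorem finite_isPalSub (s : List α) : {u | IsPalSub s u}.Finite :=
  (List.finite_toSet s.sublists).subset fun _ hu => List.mem_sublists.2 hu.2.2.sublist

theorem ncard_occ (s : List α) {v : List α} (hv : v ≠ []) (hp : v.Palindrome) :
    (occ s v).ncard = {e ∈ Finset.Icc 1 s.length | v <:+ sufpal s e}.card := by
  have hinj : Set.InjOn (fun i => i + v.length - 1) (occ s v) := by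
    rintro i ⟨hi, -⟩ j ⟨hj, -⟩ hij
    dsimp only at hij
    omega
  rw [← hinj.ncard_image, image_occ s hv, ← Set.ncard_coe_finset]
  congr 1
  ext e
  simp only [Set.mem_ofPred_eq, Finset.coe_filter, Finset.mem_Icc, and_assoc]
  exact and_congr_right fun h1 => and_congr_right fun h2 => (suffix_sufpal_iff s h1 h2 hv hp).symm

theorem cnt_eq_card (s u : List α) :
    cnt s u = {e ∈ Finset.Icc 1 s.length | sufpal s e = u}.card := by
  rw [cnt, sufcnt, ← Set.ncard_coe_finset]
  congr 1
  ext e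
  simp [and_assoc]

end DEE

/-- For every non-empty palindromic substring `v` of `s`, the number of
occurrences of `v` in `s` equals the sum of `cnt(s,u)` over all non-empty palindromic
substrings `u` of `s` having `v` as a (not necessarily proper) suffix. -/
theorem occ_ncard_eq_sum_cnt {α : Type*} (s v : List α) (hv : DEE.IsPalSub s v) :
    (DEE.occ s v).ncard =
      ∑ᶠ u ∈ {u : List α | DEE.IsPalSub s u ∧ v <:+ u}, DEE.cnt s u := by
  have hfin : {u : List α | DEE.IsPalSub s u ∧ v <:+ u}.Finite :=
    (DEE.finite_isPalSub s).subset fun _ hu => hu.1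
  rw [finsum_mem_eq_finite_toFinset_sum _ hfin, DEE.ncard_occ s hv.1 hv.2.1,
    Finset.card_eq_sum_card_fiberwise (f := DEE.sufpal s) (t := hfin.toFinset)]
  · refine Finset.sum_congr rfl fun u hu => ?_
    rw [DEE.cnt_eq_card, Finset.filter_filter]
    congr 1
    refine Finset.filter_congr fun e _ => ?_
    refine ⟨And.right, fun h => ⟨?_, h⟩⟩
    rw [h]
    exact (hfin.mem_toFinset.1 hu).2
  · intro e he
    obtain ⟨he, hs⟩ := Finset.mem_filter.1 he
    obtain ⟨h1, h2⟩ := Finset.mem_Icc.1 he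
    exact hfin.mem_toFinset.2 ⟨DEE.isPalSub_sufpal s h1 h2, hs⟩
end
end

section
/- Let s be a string and let v be a non-empty palindromic substring of s. A set S(v) of positions satisfies occ(s,v) = S(v) ∪ ⋃_u (occ(s,u) ∪ overline-occ(s,u)) — where the union ranges over the non-empty palindromic substrings u of s with link(u) = v — if and only if surf(s,v) ⊆ S(v) ⊆ occ(s,v). -/
noncomputable section
open scoped Classical

namespace DEE

variable {α : Type*}

theorem substr_append (a t b : List α) :
    substr (a ++ t ++ b) (a.length + 1) (a.length + t.length) = t := by
  have h : a.length + t.length + 1 - (a.length + 1) = t.length := by omega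
  simp [substr, h]

theorem mem_occ_iff {s t : List α} (ht : t ≠ []) {i : ℕ} :
    i ∈ occ s t ↔ ∃ a b, s = a ++ t ++ b ∧ i = a.length + 1 := by
  have hpos := List.length_pos_iff.2 ht
  constructor
  · rintro ⟨h1, h2, h3⟩
    refine ⟨s.take (i - 1), (s.drop (i - 1)).drop t.length, ?_, ?_⟩
    · conv_rhs => enter [1, 2]; rw [← h3]
      rw [List.append_assoc, List.take_append_drop, List.take_append_drop]
    · rw [List.length_take]
      omega
  · rintro ⟨a, b, rfl, rfl⟩
    refine ⟨by omega, ?_, ?_⟩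
    · simp only [List.length_append]
      omega
    · simp

theorem link_spec {u : List α} (hu : u ≠ []) :
    link u <:+ u ∧ (link u).Palindrome ∧ (link u).length < u.length ∧
      ∀ w, w <:+ u → w.Palindrome → w.length < u.length → w.length ≤ (link u).length := by
  have hpos := List.length_pos_iff.2 hu
  have hbdd : BddAbove {l | l < u.length ∧ (u.drop (u.length - l)).Palindrome} :=
    ⟨u.length, fun _ hl => hl.1.le⟩
  have hmem : linklen u ∈ {l | l < u.length ∧ (u.drop (u.length - l)).Palindrome} :=
    Nat.sSup_mem ⟨0, hpos, by simpa using List.Palindrome.nil⟩ hbdd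
  have hlen : (link u).length = linklen u := by
    have := hmem.1
    rw [link, List.length_drop]
    omega
  refine ⟨List.drop_suffix _ _, hmem.2, hlen ▸ hmem.1, fun w hw hp hlt => ?_⟩
  rw [hlen]
  refine le_csSup hbdd ⟨hlt, ?_⟩
  rwa [← List.suffix_iff_eq_drop.1 hw]

/-- A palindrome that ends with the palindrome `v` also starts with `v`. -/
theorem append_eq_append_reverse {p v : List α} (hv : v.Palindrome)
    (h : (p ++ v).Palindrome) : p ++ v = v ++ p.reverse := by
  conv_lhs => rw [← h.reverse_eq, List.reverse_append, hv.reverse_eq]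

/-- A palindrome that starts with the palindrome `v` also ends with `v`. -/
theorem append_eq_reverse_append {v q : List α} (hv : v.Palindrome)
    (h : (v ++ q).Palindrome) : v ++ q = q.reverse ++ v := by
  conv_lhs => rw [← h.reverse_eq, List.reverse_append, hv.reverse_eq]

theorem surface_append_iff {a v b : List α} (hv : v ≠ []) (hp : v.Palindrome) :
    Surface (a ++ v ++ b) (a.length + 1) (a.length + v.length) ↔
      (∀ p, p <:+ a → p ≠ [] → ¬ (p ++ v).Palindrome) ∧
      (∀ q, q <+: b → q ≠ [] → ¬ (v ++ q).Palindrome) := by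
  have hpos := List.length_pos_iff.2 hv
  constructor
  · rintro ⟨-, -, -, -, hl, hr⟩
    constructor
    · rintro p ⟨c, rfl⟩ hne hpal
      have := List.length_pos_iff.2 hne
      refine hl (c.length + 1) (by omega) (by simp; omega) ?_
      have h := substr_append c (p ++ v) b
      simp only [List.length_append, List.append_assoc, Nat.add_assoc] at h ⊢
      rwa [h]
    · rintro q ⟨c, rfl⟩ hne hpal
      have := List.length_pos_iff.2 hne
      refine hr (a.length + (v ++ q).length) (by simp; omega) (by simp) ?_
      have h := substr_append a (v ++ q) c
      simp only [List.append_assoc] at h ⊢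
      rwa [h]
  · rintro ⟨hl, hr⟩
    refine ⟨by omega, by omega, by simp, by rwa [substr_append], ?_, ?_⟩
    · intro l h1 h2 hpal
      refine hl (a.drop (l - 1)) (List.drop_suffix _ _) ?_ ?_
      · rw [← List.length_pos_iff, List.length_drop]
        omega
      · have h := substr_append (a.take (l - 1)) (a.drop (l - 1) ++ v) b
        rw [← List.append_assoc, List.take_append_drop, List.length_append,
          List.length_take, List.length_drop] at h
        rwa [← h, show min (l - 1) a.length + 1 = l by omega,
          show min (l - 1) a.length + (a.length - (l - 1) + v.length) =
            a.length + v.length by omega]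
    · intro r h1 h2 hpal
      simp only [List.length_append] at h2
      refine hr (b.take (r - (a.length + v.length))) (List.take_prefix _ _) ?_ ?_
      · rw [← List.length_pos_iff, List.length_take]
        omega
      · have h := substr_append a (v ++ b.take (r - (a.length + v.length)))
          (b.drop (r - (a.length + v.length)))
        rw [← List.append_assoc, List.append_assoc (a ++ v), List.take_append_drop,
          List.length_append, List.length_take] at h
        rwa [← h, show a.length + (v.length + min (r - (a.length + v.length)) b.length) = r
          by omega]

/-- A palindrome `p ++ v` with palindromic suffix `v` links to `v` if no shorter extension
of `v` to the left inside `p ++ v` is a palindrome. -/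
theorem link_append_eq {p v : List α} (hv : v.Palindrome) (hp : p ≠ [])
    (hmin : ∀ p', p' <:+ p → p' ≠ [] → p'.length < p.length → ¬ (p' ++ v).Palindrome) :
    link (p ++ v) = v := by
  have hpos := List.length_pos_iff.2 hp
  obtain ⟨hs, hpal, hlt, hmax⟩ := link_spec (u := p ++ v) (by simp [hp])
  have hle := hmax v (List.suffix_append _ _) hv (by simp; omega)
  obtain ⟨p', hp'⟩ := List.suffix_of_suffix_length_le (List.suffix_append p v) hs hle
  rw [← hp'] at hs hpal hlt ⊢
  by_contra hne
  refine hmin p' ((List.suffix_append_inj_of_length_eq rfl).1 hs).1 ?_ ?_ hpal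
  · rintro rfl
    exact hne rfl
  · simpa using hlt

theorem exists_shortest_of_exists {P : List α → Prop} (h : ∃ p, P p) :
    ∃ p, P p ∧ ∀ p', P p' → p.length ≤ p'.length := by
  obtain ⟨p, hp, hmin⟩ := (measure (List.length (α := α))).wf.has_min {p | P p} h
  exact ⟨p, hp, fun p' hp' => not_lt.1 (hmin p' hp')⟩

theorem biUnion_occ_union_obar_eq {s v : List α} (hv : v ≠ []) (hpv : v.Palindrome) :
    ⋃ u ∈ {u : List α | IsPalSub s u ∧ link u = v}, (occ s u ∪ obar s u) =
      occ s v \ surf s v := by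
  have hsurf : ∀ a b : List α, s = a ++ v ++ b → (a.length + 1 ∈ surf s v ↔
      Surface (a ++ v ++ b) (a.length + 1) (a.length + v.length)) := by
    rintro a b rfl
    have hocc : a.length + 1 ∈ occ (a ++ v ++ b) v := (mem_occ_iff hv).2 ⟨a, b, rfl, rfl⟩
    rw [surf, Set.mem_sep_iff, show a.length + 1 + v.length - 1 = a.length + v.length by omega]
    exact and_iff_right hocc
  ext i
  simp only [Set.mem_iUnion, Set.mem_ofPred_eq, exists_prop, Set.mem_sdiff]
  constructor
  · rintro ⟨u, ⟨⟨hu, hpu, -⟩, hlink⟩, hi⟩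
    obtain ⟨⟨p, hp⟩, -, hlt, -⟩ := link_spec hu
    rw [hlink] at hp hlt
    subst hp
    have hpne : p ≠ [] := by
      rintro rfl
      simp at hlt
    rcases hi with hi | ⟨k, hk, hki⟩
    · obtain ⟨a, b, hs, rfl⟩ := (mem_occ_iff hu).1 hi
      have hs' : s = a ++ v ++ (p.reverse ++ b) := by
        rw [hs, append_eq_append_reverse hpv hpu]
        simp
      refine ⟨(mem_occ_iff hv).2 ⟨_, _, hs', rfl⟩, ?_⟩
      rw [hsurf _ _ hs', surface_append_iff hv hpv]
      rintro ⟨-, h⟩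
      refine h p.reverse (List.prefix_append _ _) (by simpa) ?_
      rwa [← append_eq_append_reverse hpv hpu]
    · obtain ⟨a, b, hs, rfl⟩ := (mem_occ_iff hu).1 hk
      have hs' : s = (a ++ p) ++ v ++ b := by
        rw [hs]
        simp
      have hi' : i = (a ++ p).length + 1 := by
        simp only [hlink, List.length_append] at hki ⊢
        omega
      subst hi'
      refine ⟨(mem_occ_iff hv).2 ⟨_, _, hs', rfl⟩, ?_⟩
      rw [hsurf _ _ hs', surface_append_iff hv hpv]
      rintro ⟨h, -⟩
      exact h p (List.suffix_append _ _) hpne hpu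
  · rintro ⟨hocc, hns⟩
    obtain ⟨a, b, hs, rfl⟩ := (mem_occ_iff hv).1 hocc
    rw [hsurf _ _ hs, surface_append_iff hv hpv, not_and_or] at hns
    push Not at hns
    rcases hns with h | h
    · obtain ⟨p, ⟨⟨c, rfl⟩, hpne, hpal⟩, hmin⟩ := exists_shortest_of_exists h
      have hlink : link (p ++ v) = v := by
        refine link_append_eq hpv hpne fun p' hs' hne hlt hpal' => ?_
        have := hmin p' ⟨hs'.trans (List.suffix_append _ _), hne, hpal'⟩
        omega
      have hs' : s = c ++ (p ++ v) ++ b := by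
        rw [hs]
        simp
      have hne : p ++ v ≠ [] := by simp [hpne]
      refine ⟨p ++ v, ⟨⟨hne, hpal, c, b, hs'.symm⟩, hlink⟩, Or.inr
        ⟨c.length + 1, (mem_occ_iff hne).2 ⟨_, _, hs', rfl⟩, ?_⟩⟩
      simp only [hlink, List.length_append]
      omega
    · obtain ⟨q, ⟨⟨c, rfl⟩, hqne, hpal⟩, hmin⟩ := exists_shortest_of_exists h
      have hrev := append_eq_reverse_append hpv hpal
      have hlink : link (v ++ q) = v := by
        rw [hrev]
        refine link_append_eq hpv (by simpa) fun p' hs' hne hlt hpal' => ?_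
        have := hmin p'.reverse ⟨?_, by simpa, ?_⟩
        · simp only [List.length_reverse] at hlt this
          omega
        · rw [← List.reverse_suffix, List.reverse_reverse, List.reverse_append]
          exact hs'.trans (List.suffix_append _ _)
        · rwa [← append_eq_append_reverse hpv hpal']
      have hs' : s = a ++ (v ++ q) ++ c := by
        rw [hs]
        simp
      have hne : v ++ q ≠ [] := by simp [hqne]
      exact ⟨v ++ q, ⟨⟨hne, hpal, a, c, hs'.symm⟩, hlink⟩, Or.inl
        ((mem_occ_iff hne).2 ⟨_, _, hs', rfl⟩)⟩

end DEE


/-- For a non-empty palindromic substring `v` of `s`, a set `S` of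
positions satisfies Eq.(★) at `v` iff `surf(s,v) ⊆ S ⊆ occ(s,v)`. -/
theorem reduced_set_iff_surf {α : Type*} (s v : List α) (hv : DEE.IsPalSub s v)
    (S : Set ℕ) :
    (DEE.occ s v =
        S ∪ ⋃ u ∈ {u : List α | DEE.IsPalSub s u ∧ DEE.link u = v},
              (DEE.occ s u ∪ DEE.obar s u)) ↔
      DEE.surf s v ⊆ S ∧ S ⊆ DEE.occ s v := by
  rw [DEE.biUnion_occ_union_obar_eq hv.1 hv.2.1]
  have hsub : DEE.surf s v ⊆ DEE.occ s v := Set.sep_subset _ _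
  constructor
  · intro h
    refine ⟨fun i hi => ?_, h ▸ Set.subset_union_left⟩
    rcases h ▸ hsub hi with hS | hS
    · exact hS
    · exact absurd hi hS.2
  · rintro ⟨h1, h2⟩
    refine Set.Subset.antisymm (fun i hi => ?_) (Set.union_subset h2 Set.sdiff_subset)
    by_cases his : i ∈ DEE.surf s v
    · exact Or.inl (h1 his)
    · exact Or.inr ⟨hi, his⟩
end
end

section
/- Let s be a string and c a character. Let t = sufpal(sc,|sc|), the longest palindromic suffix of sc, and let t' = link(t). Then for all 1 ≤ i ≤ |sc|: presurf(sc,i) = t if i = |sc| − |t| + 1; presurf(sc,i) = ε if i = |sc| and |t| ≠ 1; and presurf(sc,i) = presurf(s,i) otherwise. Moreover, sufsurf(sc,i) = t if i = |sc|; sufsurf(sc,i) = ε if i = |sc| − |t| + |t'| and sufsurf(s, |sc| − |t| + |t'|) = t' and |t'| ≥ 1; and sufsurf(sc,i) = sufsurf(s,i) otherwise. -/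
noncomputable section
open scoped Classical

namespace DEE

/-- The window `[i, j]` of `f` reads the same in both directions. -/
def PalWindow {β : Type*} (f : ℕ → β) (i j : ℕ) : Prop :=
  ∀ x y, i ≤ x → x ≤ j → x + y = i + j → f x = f y

/-- If `[a, n]` and its proper suffix `[i, n]` are palindromic and `[i, j]` is the longest proper
palindromic prefix of `[i, n]`, then `[i, j]` extends to the left to a longer palindrome. -/
theorem PalWindow.exists_left_extension {β : Type*} {f : ℕ → β} {a i j n : ℕ} (hai : a < i)
    (hij : i ≤ j) (hjn : j < n) (han : PalWindow f a n) (hin : PalWindow f i n)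
    (hmax : ∀ r, j < r → r < n → ¬ PalWindow f i r) :
    ∃ l, a ≤ l ∧ l < i ∧ PalWindow f l j := by
  by_cases h : a + (n - j) < i
  · refine ⟨a + (n - j), by omega, h, fun x y hx hxj hxy => han x y ?_ ?_ ?_⟩ <;> omega
  by_cases h' : i = a + (n - j)
  · refine ⟨a, le_rfl, hai, fun x y hx hxj hxy => ?_⟩
    rw [han x (a + n - x) hx (by omega) (by omega), han y (a + n - y) (by omega) (by omega)
      (by omega)]
    exact hin _ _ (by omega) (by omega) (by omega)
  · exfalso
    refine hmax (n - (i - a)) (by omega) (by omega) fun x y hx hxr hxy => han x y ?_ ?_ ?_ <;> omega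

variable {α : Type*}

theorem length_substr {s : List α} {i j : ℕ} (hi : 1 ≤ i) (hj : j ≤ s.length) :
    (substr s i j).length = j + 1 - i := by
  simp only [substr, List.length_take, List.length_drop]; omega

theorem getElem?_substr {s : List α} {i j k : ℕ} (hk : k < j + 1 - i) :
    (substr s i j)[k]? = s[i - 1 + k]? := by
  simp [substr, hk, List.getElem?_drop]

theorem palindrome_substr_iff {s : List α} {i j : ℕ} (hi : 1 ≤ i) (hj : j ≤ s.length) :
    (substr s i j).Palindrome ↔ PalWindow (fun x => s[x - 1]?) i j := by
  have hlen := length_substr hi hj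
  rw [List.Palindrome.iff_reverse_eq]
  constructor
  · intro h x y hx hxj hxy
    have h1 : (substr s i j).reverse[x - i]? = (substr s i j)[x - i]? := by rw [h]
    rw [List.getElem?_reverse (by omega), getElem?_substr (by omega),
      getElem?_substr (by omega)] at h1
    simp only
    rw [show x - 1 = i - 1 + (x - i) by omega, ← h1]
    congr 1; omega
  · intro h
    apply List.ext_getElem?
    intro k
    by_cases hk : k < j + 1 - i
    · rw [List.getElem?_reverse (by omega), getElem?_substr (by omega), getElem?_substr hk]
      have := h (i + k) (j - k) (by omega) (by omega) (by omega)
      simp only at this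
      rw [show i - 1 + k = i + k - 1 by omega, this]
      congr 1; omega
    · rw [List.getElem?_eq_none (by simp; omega), List.getElem?_eq_none (by omega)]

theorem substr_append_singleton {s : List α} {c : α} {i j : ℕ} (hi : 1 ≤ i) (hj : j ≤ s.length) :
    substr (s ++ [c]) i j = substr s i j := by
  apply List.ext_getElem?
  intro k
  by_cases hk : k < j + 1 - i
  · rw [getElem?_substr hk, getElem?_substr hk, List.getElem?_append_left (by omega)]
  · rw [List.getElem?_eq_none (by rw [length_substr hi (by simp; omega)]; omega),
      List.getElem?_eq_none (by rw [length_substr hi hj]; omega)]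

theorem palindrome_substr_self {s : List α} {i : ℕ} (hi : 1 ≤ i) (his : i ≤ s.length) :
    (substr s i i).Palindrome := by
  rw [palindrome_substr_iff hi his]
  intro x y hx hx' hxy
  rw [show x = y by omega]

theorem Surface.left_unique {s : List α} {i i' j : ℕ} (h : Surface s i j) (h' : Surface s i' j) :
    i = i' := by
  obtain ⟨h1, -, -, h4, h5, -⟩ := h
  obtain ⟨h1', -, -, h4', h5', -⟩ := h'
  by_contra hne
  rcases Nat.lt_or_gt_of_ne hne with hlt | hlt
  · exact h5' i h1 hlt h4
  · exact h5 i' h1' hlt h4'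

theorem presurf_eq_of_surface {s : List α} {i j : ℕ} (h : Surface s i j) :
    presurf s i = substr s i j := by
  have hlen : prelen s i = j + 1 - i := by
    obtain ⟨h1, h2, h3, h4, -, h6⟩ := h
    refine IsGreatest.csSup_eq ⟨⟨by omega, by omega, ?_⟩, ?_⟩
    · rwa [show i + (j + 1 - i) - 1 = j by omega]
    · rintro l ⟨hl1, hl2, hl3⟩
      by_contra hlt
      exact h6 _ (by omega) (by omega) hl3
  have hj : i + prelen s i - 1 = j := by have := h.2.1; omega
  rw [presurf, prepal, hj, if_pos h]

theorem sufsurf_eq_of_surface {s : List α} {i j : ℕ} (h : Surface s i j) :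
    sufsurf s j = substr s i j := by
  have hlen : suflen s j = j + 1 - i := by
    obtain ⟨h1, h2, h3, h4, h5, -⟩ := h
    refine IsGreatest.csSup_eq ⟨⟨by omega, by omega, ?_⟩, ?_⟩
    · rwa [show j + 1 - (j + 1 - i) = i by omega]
    · rintro l ⟨hl1, hl2, hl3⟩
      by_contra hlt
      exact h5 _ (by omega) (by omega) hl3
  have hi : j + 1 - suflen s j = i := by have := h.2.1; omega
  rw [sufsurf, sufpal, hi, if_pos h]

theorem presurf_eq_nil {s : List α} {i : ℕ} (h : ∀ j, ¬ Surface s i j) : presurf s i = [] :=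
  if_neg (h _)

theorem sufsurf_eq_nil {s : List α} {j : ℕ} (h : ∀ i, ¬ Surface s i j) : sufsurf s j = [] :=
  if_neg (h _)

/-- The longest palindromic suffix of a non-empty string is a surface. -/
theorem exists_surface_eq_sufpal {s : List α} (hs : 1 ≤ s.length) :
    ∃ a, Surface s a s.length ∧ sufpal s s.length = substr s a s.length := by
  set S : Set ℕ := {l | 1 ≤ l ∧ l ≤ s.length ∧ (substr s (s.length + 1 - l) s.length).Palindrome}
  have hbdd : BddAbove S := ⟨s.length, fun l hl => hl.2.1⟩
  have hne : S.Nonempty := ⟨1, le_rfl, hs, by simpa using palindrome_substr_self hs le_rfl⟩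
  obtain ⟨h1, h2, h3⟩ : suflen s s.length ∈ S := Nat.sSup_mem hne hbdd
  refine ⟨s.length + 1 - suflen s s.length, ⟨by omega, by omega, le_rfl, h3, ?_, ?_⟩, rfl⟩
  · intro l hl hlt hpal
    have hmem : s.length + 1 - l ∈ S :=
      ⟨by omega, by omega, by rwa [show s.length + 1 - (s.length + 1 - l) = l by omega]⟩
    have : s.length + 1 - l ≤ suflen s s.length := le_csSup hbdd hmem
    omega
  · intro r hr hr'
    omega

theorem Surface.of_append_singleton {s : List α} {c : α} {i j : ℕ} (hj : j ≤ s.length)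
    (h : Surface (s ++ [c]) i j) : Surface s i j := by
  obtain ⟨h1, h2, -, h4, h5, h6⟩ := h
  refine ⟨h1, h2, hj, ?_, fun l hl hli => ?_, fun r hr hrs => ?_⟩
  · rwa [substr_append_singleton h1 hj] at h4
  · rw [← substr_append_singleton (c := c) hl hj]
    exact h5 l hl hli
  · rw [← substr_append_singleton (c := c) h1 hrs]
    exact h6 r hr (by simp; omega)

/-- Appending a character can only destroy a surface that starts where the longest palindromic
suffix of the extended string does. -/
theorem Surface.append_singleton {s : List α} {c : α} {a i j : ℕ}
    (h : Surface s i j) (ha : Surface (s ++ [c]) a (s ++ [c]).length) (hia : i ≠ a) :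
    Surface (s ++ [c]) i j := by
  obtain ⟨h1, h2, h3, h4, h5, h6⟩ := h
  obtain ⟨ha1, -, -, ha4, ha5, -⟩ := ha
  have hn : (s ++ [c]).length = s.length + 1 := by simp
  refine ⟨h1, h2, by omega, ?_, fun l hl hli => ?_, fun r hr hrs hpal => ?_⟩
  · rwa [substr_append_singleton h1 h3]
  · rw [substr_append_singleton hl h3]
    exact h5 l hl hli
  · by_cases hrn : r ≤ s.length
    · rw [substr_append_singleton h1 hrn] at hpal
      exact h6 r hr hrn hpal
    · obtain rfl : r = (s ++ [c]).length := by omega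
      have hai : a < i := by
        by_contra hlt
        exact ha5 i h1 (by omega) hpal
      rw [palindrome_substr_iff (by omega) le_rfl] at ha4 hpal
      obtain ⟨l, hal, hli, hl⟩ := ha4.exists_left_extension hai h2 (by omega) hpal
        (fun r' hr' hr'n hpal' => h6 r' hr' (by omega) <| by
          rwa [← palindrome_substr_iff h1 (by omega),
            substr_append_singleton h1 (by omega)] at hpal')
      rw [← palindrome_substr_iff (by omega) (by omega),
        substr_append_singleton (by omega) h3] at hl
      exact h5 l (by omega) hli hl

/-- For a palindrome, `link` is also its longest proper palindromic prefix. -/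
theorem link_eq_take {t : List α} (ht : t.Palindrome) {m : ℕ} (hm : m < t.length)
    (hpal : (t.take m).Palindrome) (hmax : ∀ l, m < l → l < t.length → ¬ (t.take l).Palindrome) :
    link t = t.take m := by
  have hdrop : ∀ l, l ≤ t.length → t.drop (t.length - l) = (t.take l).reverse := by
    intro l hl
    rw [List.reverse_take, ht.reverse_eq]
  have hlen : linklen t = m := by
    refine IsGreatest.csSup_eq ⟨⟨hm, ?_⟩, ?_⟩
    · rwa [hdrop m hm.le, hpal.reverse_eq]
    · rintro l ⟨hl, hl'⟩
      by_contra hlt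
      rw [hdrop l hl.le, List.Palindrome.iff_reverse_eq, List.reverse_reverse] at hl'
      exact hmax l (by omega) hl (List.Palindrome.of_reverse_eq hl'.symm)
  rw [link, hlen, hdrop m hm.le, hpal.reverse_eq]

theorem take_substr {s : List α} {i j r : ℕ} (hrj : r ≤ j) :
    (substr s i j).take (r + 1 - i) = substr s i r := by
  rw [substr, substr, List.take_take, min_eq_left (by omega)]

theorem Surface.link_eq {s : List α} {c : α} {a j : ℕ}
    (ha : Surface (s ++ [c]) a (s ++ [c]).length) (h : Surface s a j) :
    link (substr (s ++ [c]) a (s ++ [c]).length) = substr s a j := by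
  obtain ⟨h1, h2, h3, h4, -, h6⟩ := h
  have hn : (s ++ [c]).length = s.length + 1 := by simp
  have hlen := length_substr (s := s ++ [c]) h1 le_rfl
  have htake : ∀ r, r ≤ s.length →
      (substr (s ++ [c]) a (s ++ [c]).length).take (r + 1 - a) = substr s a r := fun r hr => by
    rw [take_substr (by omega), substr_append_singleton h1 hr]
  rw [← htake j h3]
  refine link_eq_take ha.2.2.2.1 (by omega) (by rwa [htake j h3]) fun l hl hlt => ?_
  have := h6 (a + l - 1) (by omega) (by omega)
  rwa [← htake _ (by omega), show a + l - 1 + 1 - a = l by omega] at this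

end DEE

/-- (Surface recording for `push_back`.) How `presurf` and `sufsurf`
change when a character `c` is appended at the back of `s`, where `t` is the longest
palindromic suffix of `sc` and `t' = link t`. -/
theorem surface_recording_push_back {α : Type*} (s : List α) (c : α) (t t' : List α)
    (ht : t = DEE.sufpal (s ++ [c]) (s ++ [c]).length) (ht' : t' = DEE.link t) :
    ∀ i, 1 ≤ i → i ≤ (s ++ [c]).length →
      ((i = (s ++ [c]).length - t.length + 1 → DEE.presurf (s ++ [c]) i = t) ∧
       (i = (s ++ [c]).length → t.length ≠ 1 → DEE.presurf (s ++ [c]) i = []) ∧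
       (i ≠ (s ++ [c]).length - t.length + 1 →
          ¬ (i = (s ++ [c]).length ∧ t.length ≠ 1) →
          DEE.presurf (s ++ [c]) i = DEE.presurf s i)) ∧
      ((i = (s ++ [c]).length → DEE.sufsurf (s ++ [c]) i = t) ∧
       (i = (s ++ [c]).length - t.length + t'.length ∧
          DEE.sufsurf s ((s ++ [c]).length - t.length + t'.length) = t' ∧
          1 ≤ t'.length →
          DEE.sufsurf (s ++ [c]) i = []) ∧
       (i ≠ (s ++ [c]).length →
          ¬ (i = (s ++ [c]).length - t.length + t'.length ∧
              DEE.sufsurf s ((s ++ [c]).length - t.length + t'.length) = t' ∧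
              1 ≤ t'.length) →
          DEE.sufsurf (s ++ [c]) i = DEE.sufsurf s i)) := by
  have hn : (s ++ [c]).length = s.length + 1 := by simp
  obtain ⟨a, ha, hta⟩ := DEE.exists_surface_eq_sufpal (s := s ++ [c]) (by omega)
  rw [hta] at ht
  have ha1 : 1 ≤ a := ha.1
  have han : a ≤ (s ++ [c]).length := ha.2.1
  have hlen : t.length = (s ++ [c]).length + 1 - a := by rw [ht, DEE.length_substr ha1 le_rfl]
  have hstart : (s ++ [c]).length - t.length + 1 = a := by omega
  intro i hi hin
  refine ⟨⟨fun h => ?_, fun h hne => ?_, fun h hne => ?_⟩, fun h => ?_, ?_, fun h hne => ?_⟩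
  · rw [h, hstart, ht]
    exact DEE.presurf_eq_of_surface ha
  · refine DEE.presurf_eq_nil fun j hj => ?_
    obtain rfl : j = i := by have := hj.2.1; have := hj.2.2.1; omega
    have := ha.left_unique (h ▸ hj)
    omega
  · rw [hstart] at h
    have his : i ≤ s.length := by omega
    have hiff : ∀ j, DEE.Surface (s ++ [c]) i j ↔ DEE.Surface s i j := fun j => by
      refine ⟨fun hj => hj.of_append_singleton ?_, fun hj => hj.append_singleton ha h⟩
      by_contra hjs
      obtain rfl : j = (s ++ [c]).length := by have := hj.2.2.1; omega
      exact h (hj.left_unique ha)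
    by_cases hex : ∃ j, DEE.Surface s i j
    · obtain ⟨j, hj⟩ := hex
      rw [DEE.presurf_eq_of_surface hj, DEE.presurf_eq_of_surface ((hiff j).2 hj),
        DEE.substr_append_singleton hi hj.2.2.1]
    · rw [DEE.presurf_eq_nil fun j hj => hex ⟨j, hj⟩,
        DEE.presurf_eq_nil fun j hj => hex ⟨j, (hiff j).1 hj⟩]
  · rw [h, ht]
    exact DEE.sufsurf_eq_of_surface ha
  · rintro ⟨h, hsuf, hpos⟩
    rw [← h] at hsuf
    refine DEE.sufsurf_eq_nil fun k hk => ?_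
    have hlt : t'.length < t.length := by
      have hle : DEE.linklen t < t.length :=
        (Nat.sSup_mem (s := {l | l < t.length ∧ (t.drop (t.length - l)).Palindrome})
          ⟨0, by omega, by simpa using List.Palindrome.nil⟩ ⟨t.length, fun l hl => hl.1.le⟩).1
      rw [ht', DEE.link, List.length_drop]
      omega
    have his : i ≤ s.length := by omega
    have hks := hk.of_append_singleton his
    rw [DEE.sufsurf_eq_of_surface hks] at hsuf
    have hlen' := DEE.length_substr hks.1 his
    rw [hsuf] at hlen'
    obtain rfl : k = a := by have := hks.2.1; omega
    exact hk.2.2.2.2.2 _ (by omega) le_rfl ha.2.2.2.1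
  · have his : i ≤ s.length := by omega
    by_cases hex : ∃ k, DEE.Surface s k i
    · obtain ⟨k, hk⟩ := hex
      have hka : k ≠ a := by
        rintro rfl
        have hlink : t' = DEE.substr s k i := by rw [ht', ht, ha.link_eq hk]
        have hlen' : t'.length = i + 1 - k := by rw [hlink, DEE.length_substr hk.1 his]
        have hki := hk.2.1
        have hend : (s ++ [c]).length - t.length + t'.length = i := by omega
        refine hne ⟨hend.symm, ?_, by omega⟩
        rw [hend, DEE.sufsurf_eq_of_surface hk, hlink]
      rw [DEE.sufsurf_eq_of_surface hk, DEE.sufsurf_eq_of_surface (hk.append_singleton ha hka),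
        DEE.substr_append_singleton hk.1 his]
    · rw [DEE.sufsurf_eq_nil fun k hk => hex ⟨k, hk⟩,
        DEE.sufsurf_eq_nil fun k hk => hex ⟨k, hk.of_append_singleton his⟩]
end
end
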